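/- Let L be the free Lie algebra over a field K of characteristic zero on two generators e and f. Let φ : L → L be a Lie algebra endomorphism and c, d ∈ K scalars such that φ(e) − c•f ∈ L^2 and φ(f) − d•e ∈ L^2, where L^2 = ⁅L, L⁆. Then for all natural numbers n, m, φ(L_{≥n,≥m}) ⊆ L_{≥m,≥n}. In particular, each L_{≥n,≥n} is stable under φ. -/

import Mathlib

noncomputable section

namespace CMPaper

variable (K : Type*) [Field K] [CharZero K]

/-- The free Lie algebra on two generators. -/
abbrev L := FreeLieAlgebra K (Fin 2)

/-- The first generator `e`. -/
def e : L K := FreeLieAlgebra.of K (0 : Fin 2)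

/-- The second generator `f`. -/
def f : L K := FreeLieAlgebra.of K (1 : Fin 2)

/-- Iterated Lie bracket monomials in the generators in which `e` occurs exactly `i`
times and `f` occurs exactly `j` times. -/
inductive IsLieMonomial : L K → ℕ → ℕ → Prop
  | gen_e : IsLieMonomial (e K) 1 0
  | gen_f : IsLieMonomial (f K) 0 1
  | brak {x y : L K} {i j k l : ℕ} :
      IsLieMonomial x i j → IsLieMonomial y k l → IsLieMonomial ⁅x, y⁆ (i + k) (j + l)

/-- The bigraded component `L_{i,j}`: the `K`-span of the Lie monomials of bidegree `(i,j)`. -/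
def bihom (i j : ℕ) : Submodule K (L K) :=
  Submodule.span K {x : L K | IsLieMonomial K x i j}

/-- `L_{≥n,≥m}`: the submodule generated by all `L_{i,j}` with `i ≥ n`, `j ≥ m`. -/
def bihomGE (n m : ℕ) : Submodule K (L K) :=
  ⨆ (i : ℕ) (j : ℕ) (_ : n ≤ i) (_ : m ≤ j), bihom K i j

/-- The lower central series, normalized so that `lcs 1 = L` and `lcs (n+1) = ⁅L, lcs n⁆`. -/
def lcs (n : ℕ) : LieIdeal K (L K) := LieModule.lowerCentralSeries K (L K) (L K) (n - 1)

theorem mono_mem_GE {x : L K} {i j n m : ℕ} (h : IsLieMonomial K x i j) (hn : n ≤ i) (hm : m ≤ j) :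
    x ∈ bihomGE K n m := by
  have h1 : bihom K i j ≤ bihomGE K n m :=
    le_iSup_of_le i (le_iSup_of_le j (le_iSup_of_le hn (le_iSup_of_le hm le_rfl)))
  exact h1 (Submodule.subset_span h)

theorem bihomGE_le {n m : ℕ} {p : Submodule K (L K)}
    (h : ∀ x i j, n ≤ i → m ≤ j → IsLieMonomial K x i j → x ∈ p) : bihomGE K n m ≤ p := by
  refine iSup_le fun i => iSup_le fun j => iSup_le fun hn => iSup_le fun hm => ?_
  exact Submodule.span_le.2 fun x hx => h x i j hn hm hx

theorem bihomGE_anti {n m n' m' : ℕ} (hn : n' ≤ n) (hm : m' ≤ m) :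
    bihomGE K n m ≤ bihomGE K n' m' :=
  bihomGE_le K fun _ _ _ h1 h2 h => mono_mem_GE K h (hn.trans h1) (hm.trans h2)

/-- If the bracket of monomials lands in `p`, so does the bracket of the spans. -/
theorem lie_mem_of_mono {a b a' b' : ℕ} {p : Submodule K (L K)}
    (h : ∀ x y i j k l, a ≤ i → b ≤ j → a' ≤ k → b' ≤ l → IsLieMonomial K x i j →
      IsLieMonomial K y k l → ⁅x, y⁆ ∈ p)
    {x y : L K} (hx : x ∈ bihomGE K a b) (hy : y ∈ bihomGE K a' b') : ⁅x, y⁆ ∈ p := by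
  have h1 : ∀ x i j, a ≤ i → b ≤ j → IsLieMonomial K x i j →
      ∀ y ∈ bihomGE K a' b', ⁅x, y⁆ ∈ p := by
    intro x i j hi hj hx
    have : bihomGE K a' b' ≤ p.comap (LieAlgebra.ad K (L K) x) :=
      bihomGE_le K fun y k l hk hl hy => h x y i j k l hi hj hk hl hx hy
    exact fun y hy => this hy
  have h2 : bihomGE K a b ≤ p.comap (LieAlgebra.ad K (L K) y) := by
    refine bihomGE_le K fun x i j hi hj hx => ?_
    have := p.neg_mem (h1 x i j hi hj hx y hy)
    rw [lie_skew] at this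
    exact this
  have := p.neg_mem (h2 hx)
  change -⁅y, x⁆ ∈ p at this
  rwa [lie_skew] at this

theorem lie_mem_GE {a b a' b' : ℕ} {x y : L K} (hx : x ∈ bihomGE K a b)
    (hy : y ∈ bihomGE K a' b') : ⁅x, y⁆ ∈ bihomGE K (a + a') (b + b') :=
  lie_mem_of_mono K (fun _ _ _ _ _ _ h1 h2 h3 h4 hx hy =>
    mono_mem_GE K (hx.brak hy) (by omega) (by omega)) hx hy

theorem mem_GE_zero (x : L K) : x ∈ bihomGE K 0 0 := by
  have hc : ∀ x y : L K, x ∈ bihomGE K 0 0 → y ∈ bihomGE K 0 0 → ⁅x, y⁆ ∈ bihomGE K 0 0 := by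
    intro x y hx hy
    exact bihomGE_anti K (Nat.zero_le _) (Nat.zero_le _) (lie_mem_GE K hx hy)
  let S : LieSubalgebra K (L K) :=
    { bihomGE K 0 0 with lie_mem' := fun {x y} hx hy => hc x y hx hy }
  let g : L K →ₗ⁅K⁆ S := FreeLieAlgebra.lift K fun i =>
    ⟨FreeLieAlgebra.of K i, by
      change FreeLieAlgebra.of K i ∈ bihomGE K 0 0
      fin_cases i
      · exact mono_mem_GE K .gen_e (by omega) (by omega)
      · exact mono_mem_GE K .gen_f (by omega) (by omega)⟩
  have h : S.incl.comp g = LieHom.id := by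
    apply FreeLieAlgebra.hom_ext
    intro i
    simp [g]
  have h2 : ((g x : S) : L K) = x := congrArg (fun F : L K →ₗ⁅K⁆ L K => F x) h
  rw [← h2]
  exact (g x).2

theorem mono_e {x : L K} {i j : ℕ} (h : IsLieMonomial K x i j) :
    j = 0 → ∃ t : K, x = t • e K := by
  induction h with
  | gen_e => exact fun _ => ⟨1, by simp⟩
  | gen_f => intro h; omega
  | brak _ _ h1 h2 =>
    intro h
    obtain ⟨s, rfl⟩ := h1 (by omega)
    obtain ⟨t, rfl⟩ := h2 (by omega)
    exact ⟨0, by simp⟩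

theorem mono_f {x : L K} {i j : ℕ} (h : IsLieMonomial K x i j) :
    i = 0 → ∃ t : K, x = t • f K := by
  induction h with
  | gen_e => intro h; omega
  | gen_f => exact fun _ => ⟨1, by simp⟩
  | brak _ _ h1 h2 =>
    intro h
    obtain ⟨s, rfl⟩ := h1 (by omega)
    obtain ⟨t, rfl⟩ := h2 (by omega)
    exact ⟨0, by simp⟩

theorem lie_mem_GE_one (x y : L K) : ⁅x, y⁆ ∈ bihomGE K 1 1 := by
  refine lie_mem_of_mono K ?_ (mem_GE_zero K x) (mem_GE_zero K y)
  intro x y i j k l _ _ _ _ hx hy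
  by_cases h1 : i + k = 0
  · obtain ⟨s, rfl⟩ := mono_f K hx (by omega)
    obtain ⟨t, rfl⟩ := mono_f K hy (by omega)
    simp
  by_cases h2 : j + l = 0
  · obtain ⟨s, rfl⟩ := mono_e K hx (by omega)
    obtain ⟨t, rfl⟩ := mono_e K hy (by omega)
    simp
  exact mono_mem_GE K (hx.brak hy) (by omega) (by omega)

theorem lcs_two_le {x : L K} (hx : x ∈ lcs K 2) : x ∈ bihomGE K 1 1 := by
  have h : x ∈ (⁅(⊤ : LieIdeal K (L K)), (⊤ : LieIdeal K (L K))⁆ : LieIdeal K (L K)) := hx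
  rw [← LieSubmodule.mem_toSubmodule, LieSubmodule.lieIdeal_oper_eq_linear_span'] at h
  refine (Submodule.span_le.2 ?_ : _ ≤ bihomGE K 1 1) h
  rintro _ ⟨a, _, b, _, rfl⟩
  exact lie_mem_GE_one K a b

/-- If a Lie algebra endomorphism `φ` satisfies `φ(e) ≡ c • f` and `φ(f) ≡ d • e`
modulo `L² = ⁅L, L⁆`, then `φ(L_{≥n,≥m}) ⊆ L_{≥m,≥n}`; in particular each
`L_{≥n,≥n}` is stable under `φ`. -/
theorem endo_swaps_bihomGE (φ : L K →ₗ⁅K⁆ L K) (c d : K)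
    (he : φ (e K) - c • f K ∈ lcs K 2) (hf : φ (f K) - d • e K ∈ lcs K 2) :
    (∀ n m : ℕ, ∀ x ∈ bihomGE K n m, φ x ∈ bihomGE K m n) ∧
    (∀ n : ℕ, ∀ x ∈ bihomGE K n n, φ x ∈ bihomGE K n n) := by
  have hE : φ (e K) ∈ bihomGE K 0 1 := by
    rw [← sub_add_cancel (φ (e K)) (c • f K)]
    exact add_mem (bihomGE_anti K (by omega) le_rfl (lcs_two_le K he))
      (Submodule.smul_mem _ _ (mono_mem_GE K .gen_f (by omega) (by omega)))
  have hF : φ (f K) ∈ bihomGE K 1 0 := by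
    rw [← sub_add_cancel (φ (f K)) (d • e K)]
    exact add_mem (bihomGE_anti K le_rfl (by omega) (lcs_two_le K hf))
      (Submodule.smul_mem _ _ (mono_mem_GE K .gen_e (by omega) (by omega)))
  have hM : ∀ x i j, IsLieMonomial K x i j → φ x ∈ bihomGE K j i := by
    intro x i j h
    induction h with
    | gen_e => exact hE
    | gen_f => exact hF
    | brak _ _ h1 h2 =>
      rw [LieHom.map_lie]
      exact lie_mem_GE K h1 h2
  have main : ∀ n m : ℕ, ∀ x ∈ bihomGE K n m, φ x ∈ bihomGE K m n := by
    intro n m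
    have : bihomGE K n m ≤ (bihomGE K m n).comap (φ : L K →ₗ[K] L K) :=
      bihomGE_le K fun x i j hn hm hx => bihomGE_anti K hm hn (hM x i j hx)
    exact fun x hx => this hx
  exact ⟨main, fun n => main n n⟩

end CMPaper
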